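/- For every normalised PCFA A and every specification (φₑ, φ_f), the MDP-view violation probability equals the trace-view violation probability of its accepted trace set: ℙ_MDP(A ⊨ (φₑ, φ_f)) = traceProb(ℒ(A); φₑ, φ_f). -/

import Mathlib

open Classical

/-! ### Basic syntax: expressions, predicates, statements -/

inductive Dir : Type
  | L : Dir
  | R : Dir
  deriving DecidableEq

inductive AExp (V : Type) : Type
  | var : V → AExp V
  | const : ℕ → AExp V
  | add : AExp V → AExp V → AExp V
  | mul : AExp V → AExp V → AExp V
  | sub : AExp V → AExp V → AExp V

inductive BExp (V : Type) : Type
  | eq : AExp V → AExp V → BExp V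
  | le : AExp V → AExp V → BExp V
  | lt : AExp V → AExp V → BExp V
  | not : BExp V → BExp V
  | and : BExp V → BExp V → BExp V
  | or : BExp V → BExp V → BExp V
  | imp : BExp V → BExp V → BExp V

variable {V : Type}

def AExp.eval (f : V → ℕ) : AExp V → ℕ
  | .var X => f X
  | .const n => n
  | .add a b => a.eval f + b.eval f
  | .mul a b => a.eval f * b.eval f
  | .sub a b => a.eval f - b.eval f

def BExp.eval (f : V → ℕ) : BExp V → Bool
  | .eq a b => decide (a.eval f = b.eval f)
  | .le a b => decide (a.eval f ≤ b.eval f)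
  | .lt a b => decide (a.eval f < b.eval f)
  | .not b => ! b.eval f
  | .and a b => a.eval f && b.eval f
  | .or a b => a.eval f || b.eval f
  | .imp a b => (! a.eval f) || b.eval f

/-- A valuation is `Option (V → ℕ)`; `none` is the dead valuation ⊥.
Satisfaction `v ⊨ φ`: ⊥ satisfies no predicate. -/
def BExp.sat (v : Option (V → ℕ)) (φ : BExp V) : Prop :=
  ∃ f, v = some f ∧ φ.eval f = true

inductive Stmt (V : Type) : Type
  | skip : Stmt V
  | assign : V → AExp V → Stmt V
  | assume : BExp V → Stmt V
  | prob : ℕ → Dir → Stmt V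
  | nondet : ℕ → Stmt V

def Stmt.isProb : Stmt V → Bool
  | .prob _ _ => true
  | _ => false

/-- Evaluation of a statement on a valuation. -/
def Stmt.eval [DecidableEq V] (σ : Stmt V) : Option (V → ℕ) → Option (V → ℕ)
  | none => none
  | some f =>
    match σ with
    | Stmt.assign X E => some (Function.update f X (E.eval f))
    | Stmt.assume B => if B.eval f = true then some f else none
    | _ => some f

/-- Evaluation of a trace: `⟦σ₁⋯σₙ⟧ = ⟦σₙ⟧ ∘ ⋯ ∘ ⟦σ₁⟧`. -/
def traceEval [DecidableEq V] (τ : List (Stmt V)) (v : Option (V → ℕ)) : Option (V → ℕ) :=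
  τ.foldl (fun w σ => σ.eval w) v

/-- The weight of a trace: `(1/2)^k` where `k` is the number of probabilistic statements. -/
noncomputable def wt (τ : List (Stmt V)) : ENNReal :=
  (2⁻¹ : ENNReal) ^ (τ.countP Stmt.isProb)

/-- A trace is violating w.r.t. `(φe, φf)` if some valuation `v ⊨ φe` has `⟦τ⟧(v) ⊨ ¬φf`. -/
def Violating [DecidableEq V] (φe φf : BExp V) (τ : List (Stmt V)) : Prop :=
  ∃ v : Option (V → ℕ), BExp.sat v φe ∧ BExp.sat (traceEval τ v) (BExp.not φf)

/-! ### Automata -/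

/-- Underlying automaton data: statements label transitions. -/
structure PAuto (V : Type) : Type 1 where
  Loc : Type
  trans : Loc → Stmt V → Loc → Prop
  init : Loc
  ending : Set Loc

namespace PAuto

variable (A : PAuto V)

inductive Path : A.Loc → List (Stmt V) → A.Loc → Prop
  | nil (l : A.Loc) : Path l [] l
  | cons {l l' l'' : A.Loc} {σ : Stmt V} {τ : List (Stmt V)} :
      A.trans l σ l' → Path l' τ l'' → Path l (σ :: τ) l''

/-- Accepting traces: nonempty words labelling paths from the initial to an ending location. -/
def lang : Set (List (Stmt V)) :=
  {τ | τ ≠ [] ∧ ∃ l ∈ A.ending, A.Path A.init τ l}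

def Det : Prop :=
  ∀ ⦃l : A.Loc⦄ ⦃σ : Stmt V⦄ ⦃l₁ l₂ : A.Loc⦄, A.trans l σ l₁ → A.trans l σ l₂ → l₁ = l₂

/-- All transitions of `A` are labelled by statements in the alphabet `alph`. -/
def Over (alph : Finset (Stmt V)) : Prop :=
  ∀ ⦃l : A.Loc⦄ ⦃σ : Stmt V⦄ ⦃l' : A.Loc⦄, A.trans l σ l' → σ ∈ alph

/-- A general PCFA over a finite statement alphabet: finitely many locations. -/
structure IsGPCFA (alph : Finset (Stmt V)) : Prop where
  finLoc : Finite A.Loc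
  over_alph : A.Over alph

/-- A PCFA: deterministic general PCFA with a single ending location without out-transitions. -/
structure IsPCFA (alph : Finset (Stmt V)) : Prop where
  finLoc : Finite A.Loc
  over_alph : A.Over alph
  det : A.Det
  ending_unique : ∃ le : A.Loc, A.ending = {le}
  ending_no_out : ∀ l ∈ A.ending, ∀ (σ : Stmt V) (l' : A.Loc), ¬ A.trans l σ l'

/-- Normalisation condition: `Pb(i,L)` and `Pb(i,R)` out of the same location have
distinct targets. -/
def NormCond : Prop :=
  ∀ ⦃l l₁ l₂ : A.Loc⦄ ⦃i : ℕ⦄,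
    A.trans l (Stmt.prob i Dir.L) l₁ → A.trans l (Stmt.prob i Dir.R) l₂ → l₁ ≠ l₂

/-- A single-action automaton: deterministic, and from each location either all outgoing
transitions carry one common non-probabilistic statement, or all carry probabilistic
statements with one common distribution tag. (Locations may be infinite.) -/
def SingleAction : Prop :=
  A.Det ∧ ∀ q : A.Loc,
    (∃ σ : Stmt V, σ.isProb = false ∧
      ∀ ⦃σ' : Stmt V⦄ ⦃q' : A.Loc⦄, A.trans q σ' q' → σ' = σ) ∨
    (∃ i : ℕ, ∀ ⦃σ' : Stmt V⦄ ⦃q' : A.Loc⦄, A.trans q σ' q' → ∃ d : Dir, σ' = Stmt.prob i d)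

end PAuto

/-! ### Policies and the MDP view -/

inductive Act (V : Type) : Type
  | stmt : Stmt V → Act V
  | tag : ℕ → Act V

/-- The action associated to a statement: probabilistic statements give their tag. -/
def Stmt.act : Stmt V → Act V
  | .prob i _ => .tag i
  | σ => .stmt σ

/-- A policy: a (possibly infinite) set of policy states, a partial selection function,
and an initial policy state. -/
structure Policy (A : PAuto V) : Type 1 where
  S : Type
  sel : A.Loc → S → Option (Act V × S)
  s₀ : S

/-- Applying a policy to an automaton. -/
def PAuto.applyPolicy (A : PAuto V) (ψ : Policy A) : PAuto V where
  Loc := A.Loc × ψ.S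
  trans := fun p σ p' => A.trans p.1 σ p'.1 ∧ ψ.sel p.1 p.2 = some (σ.act, p'.2)
  init := (A.init, ψ.s₀)
  ending := {p | p.1 ∈ A.ending}

/-- MDP-view violation probability. -/
noncomputable def mdpProb [DecidableEq V] (A : PAuto V) (φe φf : BExp V) : ENNReal :=
  ⨆ (v : Option (V → ℕ)) (_ : BExp.sat v φe) (ψ : Policy A),
    ∑' τ : (A.applyPolicy ψ).lang,
      wt τ.1 * (if BExp.sat (traceEval τ.1 v) (BExp.not φf) then 1 else 0)

/-- The structural upper bound. -/
noncomputable def structBound (A : PAuto V) : ENNReal :=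
  ⨆ ψ : Policy A, ∑' τ : (A.applyPolicy ψ).lang, wt τ.1

/-! ### Operational semantics: computations and schedulers -/

/-- A transition with this statement is enabled at valuation `f`. -/
def Stmt.enabledAt (σ : Stmt V) (f : V → ℕ) : Prop :=
  ∀ B : BExp V, σ = Stmt.assume B → B.eval f = true

/-- Successor valuation of an enabled transition. -/
def Stmt.stepVal [DecidableEq V] (σ : Stmt V) (f : V → ℕ) : V → ℕ :=
  match σ with
  | .assign X E => Function.update f X (E.eval f)
  | _ => f

/-- `A.Run l f τ l' f'`: a computation from program state `(l, f)` to `(l', f')`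
along enabled transitions labelled `τ`. -/
inductive PAuto.Run [DecidableEq V] (A : PAuto V) :
    A.Loc → (V → ℕ) → List (Stmt V) → A.Loc → (V → ℕ) → Prop
  | nil (l : A.Loc) (f : V → ℕ) : A.Run l f [] l f
  | cons {l : A.Loc} {f : V → ℕ} {σ : Stmt V} {l' l'' : A.Loc} {τ : List (Stmt V)}
      {f'' : V → ℕ} :
      A.trans l σ l' → σ.enabledAt f → A.Run l' (σ.stepVal f) τ l'' f'' →
      A.Run l f (σ :: τ) l'' f''

/-- An automaton scheduler for initial valuation `v₀`: to each non-terminating computation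
(identified with its trace) it assigns the support of one of the three permitted
(sub-)distributions over enabled transitions: (a) Dirac on an enabled non-probabilistic
transition; (b) the fair Bernoulli on `Pb(i,L)`,`Pb(i,R)`; (c) mass 1/2 on a single
probabilistic transition. The weights of computations are independent of the scheduler, so
only the support matters. -/
structure Sched [DecidableEq V] (A : PAuto V) (v₀ : V → ℕ) : Type where
  supp : List (Stmt V) → Set (Stmt V)
  valid : ∀ (τ : List (Stmt V)) (l : A.Loc) (f : V → ℕ),
    A.Run A.init v₀ τ l f → l ∉ A.ending →
    (∃ (σ : Stmt V) (l' : A.Loc), σ.isProb = false ∧ A.trans l σ l' ∧ σ.enabledAt f ∧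
        supp τ = {σ}) ∨
    (∃ (i : ℕ) (lL lR : A.Loc), A.trans l (Stmt.prob i Dir.L) lL ∧
        A.trans l (Stmt.prob i Dir.R) lR ∧
        supp τ = {Stmt.prob i Dir.L, Stmt.prob i Dir.R}) ∨
    (∃ (i : ℕ) (d : Dir) (l' : A.Loc), A.trans l (Stmt.prob i d) l' ∧
        supp τ = {Stmt.prob i d})

/-- A computation (trace) is guided by a scheduler if each step uses a transition in the
support assigned to the preceding prefix. -/
def Sched.Guided [DecidableEq V] {A : PAuto V} {v₀ : V → ℕ} (ξ : Sched A v₀)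
    (τ : List (Stmt V)) : Prop :=
  ∀ (ρ w : List (Stmt V)) (σ : Stmt V), τ = ρ ++ σ :: w → σ ∈ ξ.supp ρ

/-- The standard violation probability. -/
noncomputable def stdProb [DecidableEq V] (A : PAuto V) (φe φf : BExp V) : ENNReal :=
  ⨆ (v₀ : V → ℕ) (_ : φe.eval v₀ = true) (ξ : Sched A v₀),
    ∑' τ : {τ : List (Stmt V) // ξ.Guided τ ∧
        ∃ (l : A.Loc) (f : V → ℕ), A.Run A.init v₀ τ l f ∧ l ∈ A.ending ∧
          φf.eval f = false},
      wt τ.1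

/-! ### Trace view -/

/-- A set of traces is mergeable if it is the language of a single-action automaton
(over a finite statement alphabet). -/
def Mergeable (Ts : Set (List (Stmt V))) : Prop :=
  ∃ M : PAuto V, (∃ alph : Finset (Stmt V), M.Over alph) ∧ M.SingleAction ∧ M.lang = Ts

/-- The trace-view violation probability of a set of traces. -/
noncomputable def traceProb [DecidableEq V] (Θ : Set (List (Stmt V))) (φe φf : BExp V) :
    ENNReal :=
  ⨆ (v : Option (V → ℕ)) (_ : BExp.sat v φe)
    (P : Set (List (Stmt V))) (_ : P ⊆ Θ) (_ : Mergeable P),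
    ∑' τ : P, wt τ.1 * (if BExp.sat (traceEval τ.1 v) (BExp.not φf) then 1 else 0)

/-! ### Substitution and weakest pre-conditions -/

def AExp.subst [DecidableEq V] (X : V) (E : AExp V) : AExp V → AExp V
  | .var Y => if Y = X then E else .var Y
  | .const n => .const n
  | .add a b => .add (AExp.subst X E a) (AExp.subst X E b)
  | .mul a b => .mul (AExp.subst X E a) (AExp.subst X E b)
  | .sub a b => .sub (AExp.subst X E a) (AExp.subst X E b)

def BExp.subst [DecidableEq V] (X : V) (E : AExp V) : BExp V → BExp V
  | .eq a b => .eq (AExp.subst X E a) (AExp.subst X E b)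
  | .le a b => .le (AExp.subst X E a) (AExp.subst X E b)
  | .lt a b => .lt (AExp.subst X E a) (AExp.subst X E b)
  | .not b => .not (BExp.subst X E b)
  | .and a b => .and (BExp.subst X E a) (BExp.subst X E b)
  | .or a b => .or (BExp.subst X E a) (BExp.subst X E b)
  | .imp a b => .imp (BExp.subst X E a) (BExp.subst X E b)

/-- Weakest pre-condition of a statement. -/
def wp [DecidableEq V] (σ : Stmt V) (φ : BExp V) : BExp V :=
  match σ with
  | .assign X E => φ.subst X E
  | .assume B => .imp B φ
  | _ => φ

/-! ### Prefix-free languages -/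

/-- A set of words is prefix-free: no element is a proper prefix of another element. -/
def PrefixFree {α : Type} (L : Set (List α)) : Prop :=
  ∀ u ∈ L, ∀ v ∈ L, u <+: v → u = v


theorem act_eq_prob {V : Type} {σ : Stmt V} {i : ℕ} (h : σ.act = Act.tag i) :
    ∃ d, σ = Stmt.prob i d := by
  cases σ <;> simp [Stmt.act] at h
  subst h
  exact ⟨_, rfl⟩

theorem act_eq_stmt {V : Type} {σ σ' : Stmt V} (h : σ.act = Act.stmt σ') :
    σ = σ' ∧ σ.isProb = false := by
  cases σ <;> simp [Stmt.act] at h <;> exact ⟨h, rfl⟩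

theorem applyPolicy_lang_subset {V : Type} (A : PAuto V) (ψ : Policy A) :
    (A.applyPolicy ψ).lang ⊆ A.lang := by
  have key : ∀ p τ q, (A.applyPolicy ψ).Path p τ q → A.Path p.1 τ q.1 := by
    intro p τ q h
    induction h with
    | nil l => exact PAuto.Path.nil _
    | cons h _ ih => exact PAuto.Path.cons h.1 ih
  rintro τ ⟨hne, q, hq, hp⟩
  exact ⟨hne, q.1, hq, key _ _ _ hp⟩

theorem applyPolicy_mergeable {V : Type} (A : PAuto V) (alph : Finset (Stmt V))
    (hover : A.Over alph) (hdet : A.Det) (ψ : Policy A) :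
    Mergeable (A.applyPolicy ψ).lang := by
  refine ⟨A.applyPolicy ψ, ⟨alph, fun l σ l' h => hover h.1⟩, ⟨?_, ?_⟩, rfl⟩
  · rintro ⟨l, s⟩ σ ⟨l₁, s₁⟩ ⟨l₂, s₂⟩ ⟨h₁, e₁⟩ ⟨h₂, e₂⟩
    have h := hdet h₁ h₂
    have e := e₁.symm.trans e₂
    simp only [Option.some.injEq, Prod.mk.injEq, true_and] at e h
    exact Prod.ext h e
  · rintro ⟨l, s⟩
    by_cases hx : ∃ σ q', σ.isProb = false ∧ (A.applyPolicy ψ).trans (l, s) σ q'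
    · obtain ⟨σ, q', hσ, -, e⟩ := hx
      refine Or.inl ⟨σ, hσ, ?_⟩
      rintro σ' q'' ⟨-, e'⟩
      have h := e'.symm.trans e
      simp only [Option.some.injEq, Prod.mk.injEq] at h
      have hs : σ.act = Act.stmt σ := by cases σ <;> simp_all [Stmt.act, Stmt.isProb]
      exact (act_eq_stmt (h.1.trans hs)).1
    · by_cases hy : ∃ σ q', (A.applyPolicy ψ).trans (l, s) σ q'
      · obtain ⟨σ, q', h⟩ := hy
        have hp : σ.isProb = true := by
          by_contra hc
          exact hx ⟨σ, q', by simpa using hc, h⟩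
        obtain ⟨i, d, rfl⟩ : ∃ i d, σ = Stmt.prob i d := by
          cases σ <;> simp_all [Stmt.isProb]
        refine Or.inr ⟨i, ?_⟩
        rintro σ' q'' ⟨-, e'⟩
        have h := e'.symm.trans h.2
        simp only [Option.some.injEq, Prod.mk.injEq] at h
        exact act_eq_prob h.1
      · refine Or.inr ⟨0, fun σ' q' h => (hy ⟨σ', q', h⟩).elim⟩

theorem single_act {V : Type} (M : PAuto V) (hM : M.SingleAction) (ρ : List (Stmt V)) :
    ∀ (q q₁ q₂ : M.Loc) (σ σ' : Stmt V) (w w' : List (Stmt V)),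
      M.Path q (ρ ++ σ :: w) q₁ → M.Path q (ρ ++ σ' :: w') q₂ → σ.act = σ'.act := by
  induction ρ with
  | nil =>
    intro q q₁ q₂ σ σ' w w' h h'
    cases h with
    | cons t _ =>
    cases h' with
    | cons t' _ =>
    rcases hM.2 q with ⟨σ₀, -, h⟩ | ⟨i, h⟩
    · rw [h t, h t']
    · obtain ⟨d, rfl⟩ := h t
      obtain ⟨d', rfl⟩ := h t'
      rfl
  | cons a ρ ih =>
    intro q q₁ q₂ σ σ' w w' h h'
    cases h with
    | cons t r =>
    cases h' with
    | cons t' r' =>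
    have e := hM.1 t t'
    subst e
    exact ih _ _ _ _ _ _ _ r r'

/-- The policy following a set of traces; a policy state records, for each location, the
trace read so far provided that this is the current location. -/
noncomputable def follow {V : Type} (A : PAuto V) (P : Set (List (Stmt V))) : Policy A where
  S := A.Loc → List (Stmt V)
  sel := fun l s =>
    if h : ∃ σ w, s l ++ σ :: w ∈ P then
      some (h.choose.act, fun l' =>
        if h' : ∃ σ, σ.act = h.choose.act ∧ A.trans l σ l' then s l ++ [h'.choose] else [])
    else none
  s₀ := fun _ => []

theorem trans_unique {V : Type} (A : PAuto V) (hnorm : A.NormCond) {l l' : A.Loc}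
    {σ σ' : Stmt V} (ha : σ.act = σ'.act) (h : A.trans l σ l') (h' : A.trans l σ' l') :
    σ = σ' := by
  cases hs : σ'.act with
  | stmt σ₀ => rw [(act_eq_stmt hs).1, (act_eq_stmt (ha.trans hs)).1]
  | tag i =>
    obtain ⟨d, rfl⟩ := act_eq_prob hs
    obtain ⟨d', rfl⟩ := act_eq_prob (ha.trans hs)
    cases d <;> cases d' <;> first | rfl | exact (hnorm h h' rfl).elim | exact (hnorm h' h rfl).elim

theorem follow_path {V : Type} (A : PAuto V) (hnorm : A.NormCond) (P : Set (List (Stmt V)))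
    (hP : ∀ ρ σ σ' w w', ρ ++ σ :: w ∈ P → ρ ++ σ' :: w' ∈ P → σ.act = σ'.act)
    (l l' : A.Loc) (w : List (Stmt V)) (hp : A.Path l w l') :
    ∀ s : A.Loc → List (Stmt V), s l ++ w ∈ P →
      ∃ s', (A.applyPolicy (follow A P)).Path (l, s) w (l', s') := by
  induction hp with
  | nil l => exact fun s _ => ⟨s, PAuto.Path.nil (A := A.applyPolicy (follow A P)) (l, s)⟩
  | @cons l l₁ l₂ σ τ t _ ih =>
    intro s hs
    have h : ∃ σ w, s l ++ σ :: w ∈ P := ⟨σ, τ, hs⟩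
    have ha : h.choose.act = σ.act := by
      obtain ⟨w, hw⟩ := h.choose_spec
      exact hP _ _ _ _ _ hw hs
    let s₁ : A.Loc → List (Stmt V) := fun l' =>
      if h' : ∃ σ, σ.act = h.choose.act ∧ A.trans l σ l' then s l ++ [h'.choose] else []
    have h' : ∃ σ, σ.act = h.choose.act ∧ A.trans l σ l₁ := ⟨σ, ha.symm, t⟩
    have hc : h'.choose = σ :=
      trans_unique A hnorm (h'.choose_spec.1.trans ha) h'.choose_spec.2 t
    have hs₁ : s₁ l₁ = s l ++ [σ] := by
      have : s₁ l₁ = s l ++ [h'.choose] := dif_pos h'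
      rw [this, hc]
    obtain ⟨s', hs'⟩ := ih s₁ (by rw [hs₁]; simpa using hs)
    have hsel : (follow A P).sel l s = some (σ.act, s₁) := by
      have : (follow A P).sel l s = some (h.choose.act, s₁) := dif_pos h
      rw [this, ha]
    exact ⟨s', PAuto.Path.cons (A := A.applyPolicy (follow A P)) (l' := (l₁, s₁)) ⟨t, hsel⟩ hs'⟩

/-- For every normalised PCFA, the MDP-view violation probability equals
the trace-view violation probability of its language. -/
theorem mdpProb_eq_traceProb {V : Type} [DecidableEq V]
    (A : PAuto V) (alph : Finset (Stmt V))
    (hfin : Finite A.Loc) (hover : A.Over alph) (hdet : A.Det) (hnorm : A.NormCond)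
    (φe φf : BExp V) :
    mdpProb A φe φf = traceProb A.lang φe φf := by
  apply le_antisymm
  · refine iSup_mono fun v => iSup_mono fun hv => iSup_le fun ψ => ?_
    refine le_iSup_of_le (A.applyPolicy ψ).lang ?_
    refine le_iSup_of_le (applyPolicy_lang_subset A ψ) ?_
    exact le_iSup_of_le (applyPolicy_mergeable A alph hover hdet ψ) le_rfl
  · refine iSup_mono fun v => iSup_mono fun hv => iSup_le fun P => iSup_le fun hsub =>
      iSup_le fun hM => ?_
    refine le_iSup_of_le (follow A P) ?_
    have hincl : P ⊆ (A.applyPolicy (follow A P)).lang := by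
      intro τ hτ
      obtain ⟨hne, l, hl, hp⟩ := hsub hτ
      obtain ⟨M, -, hS, rfl⟩ := hM
      obtain ⟨s', hs'⟩ := follow_path A hnorm M.lang
        (by
          rintro ρ σ σ' w w' ⟨-, q, -, h⟩ ⟨-, q', -, h'⟩
          exact single_act M hS ρ _ _ _ _ _ _ _ h h') _ _ _ hp (fun _ => []) (by simpa using hτ)
      exact ⟨hne, (l, s'), hl, hs'⟩
    exact ENNReal.tsum_mono_subtype
      (fun τ => wt τ * (if BExp.sat (traceEval τ v) (BExp.not φf) then 1 else 0)) hincl
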